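/- Let G be a connected unicyclic graph with m edges whose unique cycle C = v₁v₂v₃v₄v₁ has length 4 (girth 4). Suppose that there is NO index i (mod 4) with l(vᵢ) = l(v_{i+2}) = 0, l(v_{i+1}) ≤ 1 and l(v_{i+3}) ≤ 1, and there is NO index i (mod 4) with l(vᵢ) ≥ 4 or with l(vᵢ) ≥ 1, l(v_{i+1}) ≥ 2 and l(v_{i+2}) ≥ 1. Then rc(G) = m − 3. -/

import Mathlib

/-- An edge-colored graph is rainbow connected if every two vertices are
joined by a path no two of whose edges have the same color. -/
def IsRainbowConnected {V α : Type*} (G : SimpleGraph V) (c : Sym2 V → α) : Prop :=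
  ∀ u w : V, ∃ p : G.Walk u w, p.IsPath ∧ (p.edges.map c).Nodup

/-- The rainbow connection number: the minimum number of colors in an
edge-coloring making the graph rainbow connected. -/
noncomputable def rc {V : Type*} (G : SimpleGraph V) : ℕ :=
  sInf {k : ℕ | ∃ c : Sym2 V → Fin k, IsRainbowConnected G c}


/-- The set of edges of the cycle `v 0 — v 1 — ⋯ — v (s-1) — v 0`. -/
def cycleEdges {V : Type*} {s : ℕ} (v : ZMod s → V) : Set (Sym2 V) :=
  {e | ∃ i : ZMod s, e = s(v i, v (i + 1))}

/-- `numLeaves G v i` is `l(vᵢ)`: the number of leaves of the tree `T(vᵢ)`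
attached at the cycle vertex `vᵢ`, i.e. the number of vertices, other than the
root `vᵢ`, of degree 1 in the component of `G − E(C)` containing `vᵢ`. -/
noncomputable def numLeaves {V : Type*} [Fintype V] (G : SimpleGraph V) {s : ℕ}
    (v : ZMod s → V) (i : ZMod s) : ℕ :=
  {x : V | x ≠ v i ∧ (G.deleteEdges (cycleEdges v)).Reachable (v i) x ∧
    ((G.deleteEdges (cycleEdges v)).neighborSet x).ncard = 1}.ncard


open SimpleGraph

theorem cycleEdge_injective {V : Type*} {v : ZMod 4 → V} (hinj : Function.Injective v) :
    Function.Injective fun k : ZMod 4 ↦ s(v k, v (k + 1)) := by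
  intro i j h
  simp only [Sym2.eq_iff, hinj.eq_iff] at h
  revert h
  revert i j
  decide

theorem zmod4_eq_add (i j : ZMod 4) : j = i ∨ j = i + 1 ∨ j = i + 2 ∨ j + 1 = i := by
  revert i j
  decide

section Tree

variable {V : Type*}

theorem connected_deleteEdges_cycleEdge {G : SimpleGraph V} (hconn : G.Connected)
    {v : ZMod 4 → V} (hinj : Function.Injective v) (hadj : ∀ i, G.Adj (v i) (v (i + 1)))
    (k : ZMod 4) : (G.deleteEdges {s(v k, v (k + 1))}).Connected := by
  refine hconn.connected_delete_edge_of_not_isBridge ?_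
  have step : ∀ d : ZMod 4, d ≠ 0 →
      (G.deleteEdges {s(v k, v (k + 1))}).Reachable (v (k + d)) (v (k + d + 1)) := by
    intro d hd
    refine Adj.reachable (deleteEdges_adj.2 ⟨hadj _, fun h ↦ hd ?_⟩)
    simpa using cycleEdge_injective hinj h
  have h := ((step 1 (by decide)).trans (by convert step 2 (by decide) using 2; grind)).trans
    (by convert step 3 (by decide) using 2; grind)
  rw [isBridge_iff]
  intro hb
  refine hb (Reachable.symm ?_)
  convert h using 2
  rw [add_assoc, show (3 : ZMod 4) + 1 = 0 by decide, add_zero]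

theorem isTree_deleteEdges_cycleEdge [Fintype V] {G : SimpleGraph V} (hconn : G.Connected)
    (huni : G.edgeSet.ncard = Fintype.card V)
    {v : ZMod 4 → V} (hinj : Function.Injective v) (hadj : ∀ i, G.Adj (v i) (v (i + 1)))
    (k : ZMod 4) : (G.deleteEdges {s(v k, v (k + 1))}).IsTree := by
  refine isTree_iff_connected_and_card.2
    ⟨connected_deleteEdges_cycleEdge hconn hinj hadj k, ?_⟩
  rw [Nat.card_eq_fintype_card (α := V), ← huni, Nat.card_coe_set_eq, edgeSet_deleteEdges]
  exact Set.ncard_sdiff_singleton_add_one (hadj k) (Set.toFinite _)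

theorem deleteEdges_cycleEdges_le {G : SimpleGraph V} {v : ZMod 4 → V} (k : ZMod 4) :
    G.deleteEdges (cycleEdges v) ≤ G.deleteEdges {s(v k, v (k + 1))} :=
  G.deleteEdges_anti (by rintro _ rfl; exact ⟨k, rfl⟩)

theorem not_reachable_deleteEdges_pair [Fintype V] {G : SimpleGraph V} (hconn : G.Connected)
    (huni : G.edgeSet.ncard = Fintype.card V)
    {v : ZMod 4 → V} (hinj : Function.Injective v) (hadj : ∀ i, G.Adj (v i) (v (i + 1)))
    {k l : ZMod 4} (hkl : l ≠ k) :
    ¬ (G.deleteEdges {s(v k, v (k + 1)), s(v l, v (l + 1))}).Reachable (v l) (v (l + 1)) := by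
  have hT := (isTree_deleteEdges_cycleEdge hconn huni hinj hadj k).isAcyclic
  have hb := isAcyclic_iff_forall_isBridge.1 hT (e := s(v l, v (l + 1)))
    (deleteEdges_adj.2 ⟨hadj l, fun h ↦ hkl (cycleEdge_injective hinj h)⟩)
  rwa [isBridge_iff, deleteEdges_deleteEdges, Set.singleton_union] at hb

theorem eq_of_reachable_deleteEdges_cycleEdges [Fintype V] {G : SimpleGraph V}
    (hconn : G.Connected) (huni : G.edgeSet.ncard = Fintype.card V)
    {v : ZMod 4 → V} (hinj : Function.Injective v) (hadj : ∀ i, G.Adj (v i) (v (i + 1)))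
    {i j : ZMod 4} (h : (G.deleteEdges (cycleEdges v)).Reachable (v i) (v j)) : i = j := by
  have hle (k l : ZMod 4) : G.deleteEdges (cycleEdges v) ≤
      G.deleteEdges {s(v k, v (k + 1)), s(v l, v (l + 1))} :=
    G.deleteEdges_anti (by rintro _ (rfl | rfl) <;> exact ⟨_, rfl⟩)
  rcases zmod4_eq_add i j with rfl | rfl | rfl | rfl
  · rfl
  · exact (not_reachable_deleteEdges_pair hconn huni hinj hadj (k := i + 1) (by simp; decide)
      (h.mono (hle _ _))).elim
  · refine (not_reachable_deleteEdges_pair hconn huni hinj hadj (k := i + 3) (l := i)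
      (by simp; decide) ((h.mono (hle _ _)).trans (Adj.reachable ?_))).elim
    refine Adj.symm (deleteEdges_adj.2 ⟨?_, ?_⟩)
    · convert hadj (i + 1) using 2; grind
    · have h2 : i + 2 = i + 1 + 1 := by grind
      rw [h2]
      rintro (h | h)
      · have := cycleEdge_injective hinj h
        revert this; simp; decide
      · have := cycleEdge_injective hinj h
        revert this; simp; decide
  · exact (not_reachable_deleteEdges_pair hconn huni hinj hadj (k := j + 1) (by simp; decide)
      (h.symm.mono (hle _ _))).elim

theorem exists_reachable_deleteEdges_cycleEdges {G : SimpleGraph V}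
    (hconn : G.Connected) (v : ZMod 4 → V) (x : V) :
    ∃ i, (G.deleteEdges (cycleEdges v)).Reachable (v i) x := by
  obtain ⟨p⟩ := hconn.preconnected x (v 0)
  by_contra hx
  obtain ⟨d, -, hd, hd'⟩ := p.exists_boundary_dart
    {y | ¬ ∃ i, (G.deleteEdges (cycleEdges v)).Reachable (v i) y} hx
    (fun h ↦ h ⟨0, Reachable.refl _⟩)
  simp only [Set.mem_ofPred_eq, not_not] at hd hd'
  obtain ⟨i, hi⟩ := hd'
  by_cases hc : s(d.snd, d.fst) ∈ cycleEdges v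
  · obtain ⟨k, hk⟩ := hc
    rcases Sym2.eq_iff.1 hk with h | h
    · exact hd ⟨k + 1, h.2 ▸ Reachable.refl _⟩
    · exact hd ⟨k, h.2 ▸ Reachable.refl _⟩
  · exact hd ⟨i, hi.trans (Adj.reachable (deleteEdges_adj.2 ⟨d.adj.symm, hc⟩))⟩

theorem isAcyclic_deleteEdges_cycleEdges [Fintype V] {G : SimpleGraph V}
    (hconn : G.Connected) (huni : G.edgeSet.ncard = Fintype.card V)
    {v : ZMod 4 → V} (hinj : Function.Injective v) (hadj : ∀ i, G.Adj (v i) (v (i + 1))) :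
    (G.deleteEdges (cycleEdges v)).IsAcyclic :=
  (isTree_deleteEdges_cycleEdge hconn huni hinj hadj 0).isAcyclic.anti
    (deleteEdges_cycleEdges_le 0)

theorem ncard_edgeSet_deleteEdges_cycleEdges [Fintype V] {G : SimpleGraph V}
    {v : ZMod 4 → V} (hinj : Function.Injective v) (hadj : ∀ i, G.Adj (v i) (v (i + 1))) :
    (G.deleteEdges (cycleEdges v)).edgeSet.ncard + 4 = G.edgeSet.ncard := by
  have hr : cycleEdges v = Set.range fun k : ZMod 4 ↦ s(v k, v (k + 1)) := by
    ext e; simp [cycleEdges, eq_comm]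
  have hc : (cycleEdges v).ncard = 4 := by
    rw [hr, ← Set.image_univ, (cycleEdge_injective hinj).injOn.ncard_image, Set.ncard_univ,
      Nat.card_eq_fintype_card, ZMod.card]
  have hsub : cycleEdges v ⊆ G.edgeSet := by
    rintro _ ⟨k, rfl⟩
    exact hadj k
  have h := Set.ncard_sdiff_add_ncard_of_subset hsub
  rwa [hc, ← edgeSet_deleteEdges] at h

/-- A forest `H` together with a choice of a root `v i` in each of its components, and the
path from the root to every vertex. -/
structure RootedForest {ι : Type*} (H : SimpleGraph V) (v : ι → V) where
  /-- The index of the root of the component of a vertex. -/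
  root : V → ι
  /-- The path from the root to a vertex. -/
  path : ∀ x, H.Walk (v (root x)) x
  isPath : ∀ x, (path x).IsPath
  isAcyclic : H.IsAcyclic
  root_eq : ∀ {i x}, H.Reachable (v i) x → root x = i

namespace RootedForest

variable {ι : Type*} {H : SimpleGraph V} {v : ι → V}

theorem nonempty_of_reachable (hH : H.IsAcyclic) (hcover : ∀ x, ∃ i, H.Reachable (v i) x)
    (hsep : ∀ i j, H.Reachable (v i) (v j) → i = j) : Nonempty (RootedForest H v) := by
  choose r hr using hcover
  choose p hp using fun x ↦ (hr x).exists_isPath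
  exact ⟨⟨r, p, hp, hH, fun {i x} h ↦ hsep _ _ ((hr x).trans h.symm)⟩⟩

variable (F : RootedForest H v)

/-- The edges on the path from the root to a vertex. -/
def pathEdges (x : V) : Set (Sym2 V) := {e | e ∈ (F.path x).edges}

theorem root_self (i : ι) : F.root (v i) = i := F.root_eq (Reachable.refl _)

theorem root_eq_of_adj {x y : V} (h : H.Adj x y) : F.root x = F.root y :=
  (F.root_eq ((F.path x).reachable.trans h.reachable)).symm

theorem pathEdges_subset (x : V) : F.pathEdges x ⊆ H.edgeSet := fun _ he ↦
  (F.path x).edges_subset_edgeSet he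

theorem notMem_pathEdges_root (i : ι) (e : Sym2 V) : e ∉ F.pathEdges (v i) := by
  have h : (F.path (v i)).Nil :=
    (F.isPath _).nil_iff_eq.2 (congrArg v (F.root_self i))
  simp [pathEdges, Walk.edges_eq_nil.2 h]

theorem root_eq_of_mem {x y : V} {e : Sym2 V} (hx : e ∈ F.pathEdges x) (hy : e ∈ F.pathEdges y) :
    F.root x = F.root y := by
  classical
  induction e with
  | _ a b =>
    have key : ∀ z, s(a, b) ∈ F.pathEdges z → F.root a = F.root z := fun z hz ↦
      F.root_eq ((F.path z).takeUntil a ((F.path z).fst_mem_support_of_mem_edges hz)).reachable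
    rw [← key x hx, ← key y hy]

theorem pathEdges_adj {x y : V} (h : H.Adj x y) :
    (F.pathEdges y = insert s(x, y) (F.pathEdges x) ∧ s(x, y) ∉ F.pathEdges x ∧
      x = (F.path y).penultimate) ∨
    (F.pathEdges x = insert s(x, y) (F.pathEdges y) ∧ s(x, y) ∉ F.pathEdges y ∧
      y = (F.path x).penultimate) := by
  have key : ∀ {a b i j : V} (hij : i = j) (hab : H.Adj a b) (p : H.Walk i a) (q : H.Walk j b),
      p.IsPath → q.IsPath → a ∈ q.support →
      (∀ e, e ∈ q.edges ↔ e = s(a, b) ∨ e ∈ p.edges) ∧ s(a, b) ∉ p.edges ∧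
        a = q.penultimate := by
    rintro a b i _ rfl hab p q hp hq ha
    obtain rfl := F.isAcyclic.path_concat hp hq hab ha
    refine ⟨fun e ↦ ?_, fun he ↦ ?_, ?_⟩
    · simp [Walk.edges_concat, or_comm]
    · have := hq.isTrail.edges_nodup
      simp [Walk.edges_concat, List.nodup_append] at this
      exact this.2 _ he rfl
    · simp
  have hr := congrArg v (F.root_eq_of_adj h)
  by_cases hx : x ∈ (F.path y).support
  · left
    obtain ⟨h1, h2, h3⟩ := key hr h _ _ (F.isPath x) (F.isPath y) hx
    exact ⟨Set.ext h1, h2, h3⟩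
  · right
    have hy : y ∈ (F.path x).support := by
      refine F.isAcyclic.mem_support_of_ne_mem_support_of_adj_of_isPath
        (q := (F.path y).copy hr.symm rfl) (F.isPath x) ?_ h ?_
      · simpa using F.isPath y
      · simpa using hx
    obtain ⟨h1, h2, h3⟩ := key hr.symm h.symm _ _ (F.isPath y) (F.isPath x) hy
    rw [Sym2.eq_swap]
    exact ⟨Set.ext h1, h2, h3⟩

theorem mem_pathEdges_or_of_adj {x y : V} (h : H.Adj x y) :
    s(x, y) ∈ F.pathEdges x ∨ s(x, y) ∈ F.pathEdges y := by
  rcases F.pathEdges_adj h with h | h <;> simp [h.1]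

theorem exists_mem_pathEdges {e : Sym2 V} (he : e ∈ H.edgeSet) : ∃ x, e ∈ F.pathEdges x := by
  induction e with
  | _ a b => exact (F.mem_pathEdges_or_of_adj he).elim (fun h ↦ ⟨a, h⟩) fun h ↦ ⟨b, h⟩

theorem eq_of_adj_of_mem_of_notMem {x y : V} {e : Sym2 V} (h : H.Adj x y)
    (hx : e ∈ F.pathEdges x) (hy : e ∉ F.pathEdges y) : e = s(x, y) := by
  rcases F.pathEdges_adj h with h | h
  · exact absurd (h.1 ▸ Set.mem_insert_of_mem _ hx) hy
  · exact (h.1 ▸ hx : e ∈ insert s(x, y) (F.pathEdges y)).resolve_right hy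

theorem exists_adj_of_ne {x : V} (hx : x ≠ v (F.root x)) :
    H.Adj x (F.path x).penultimate :=
  ((F.path x).adj_penultimate fun h ↦ hx h.eq.symm).symm

theorem exists_leaf [Finite V] {e : Sym2 V} (he : e ∈ H.edgeSet) :
    ∃ x, e ∈ F.pathEdges x ∧ (H.neighborSet x).ncard = 1 := by
  obtain ⟨x, hx, hmax⟩ := Set.exists_max_image {x | e ∈ F.pathEdges x}
    (fun x ↦ (F.pathEdges x).ncard) (Set.toFinite _) (F.exists_mem_pathEdges he)
  refine ⟨x, hx, Set.ncard_eq_one.2 ⟨(F.path x).penultimate, ?_⟩⟩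
  have hne : x ≠ v (F.root x) := fun h ↦ F.notMem_pathEdges_root (F.root x) e (h ▸ hx)
  refine Set.eq_singleton_iff_unique_mem.2 ⟨F.exists_adj_of_ne hne, fun w hw ↦ ?_⟩
  rcases F.pathEdges_adj hw with ⟨h1, h2, -⟩ | ⟨-, -, h3⟩
  · have := hmax w (h1 ▸ Set.mem_insert_of_mem _ hx : e ∈ F.pathEdges w)
    rw [h1, Set.ncard_insert_of_notMem h2] at this
    omega
  · exact h3

theorem exists_mem_pathEdges_iff_eq {x : V} (hx : x ≠ v (F.root x))
    (hdeg : (H.neighborSet x).ncard = 1) : ∃ e, ∀ z, e ∈ F.pathEdges z ↔ z = x := by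
  obtain ⟨w, hw⟩ := Set.ncard_eq_one.1 hdeg
  have hadj : H.Adj x (F.path x).penultimate := F.exists_adj_of_ne hx
  have hnb : ∀ {z}, H.Adj x z → z = w := fun {z} hz ↦ by
    have : z ∈ H.neighborSet x := hz
    simpa [hw] using this
  have hpw := hnb hadj
  rw [hpw] at hadj
  have hpar : s(x, w) ∈ F.pathEdges x ∧ s(x, w) ∉ F.pathEdges w := by
    rcases F.pathEdges_adj hadj with ⟨-, h2, -⟩ | ⟨h1, h2, -⟩
    · have := (F.path x).mk_penultimate_end_mem_edges fun h ↦ hx h.eq.symm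
      rw [hpw, Sym2.eq_swap] at this
      exact absurd this h2
    · exact ⟨h1 ▸ Set.mem_insert _ _, h2⟩
  refine ⟨s(x, w), fun z ↦ ⟨fun hz ↦ ?_, fun h ↦ h ▸ hpar.1⟩⟩
  by_contra hzx
  obtain ⟨d, -, ⟨hd1, hd1'⟩, hd2⟩ := (F.path z).reverse.exists_boundary_dart
    {y | s(x, w) ∈ F.pathEdges y ∧ y ≠ x} ⟨hz, hzx⟩
    (fun h ↦ F.notMem_pathEdges_root _ _ h.1)
  have hd : d.snd ≠ x := by
    intro h
    have := hnb (h ▸ d.adj.symm)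
    exact hpar.2 (this ▸ hd1)
  have hd' : s(x, w) ∉ F.pathEdges d.snd := fun h ↦ hd2 ⟨h, hd⟩
  rcases Sym2.eq_iff.1 (F.eq_of_adj_of_mem_of_notMem d.adj hd1 hd') with h | h
  · exact hd1' h.1.symm
  · exact hd h.1.symm

/-- The leaves, other than the root, of the component with root `v i`. -/
def leaves (_ : RootedForest H v) (i : ι) : Set V :=
  {x | x ≠ v i ∧ H.Reachable (v i) x ∧ (H.neighborSet x).ncard = 1}

theorem card_le_ncard_leaves [Finite V] {κ : Type*} [Fintype κ] (f : κ → Sym2 V) {i : ι}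
    (hf : ∀ k, ∃ x, f k ∈ F.pathEdges x ∧ F.root x = i)
    (hinc : ∀ k l, k ≠ l → ∀ x, f k ∈ F.pathEdges x → f l ∉ F.pathEdges x) :
    Fintype.card κ ≤ (F.leaves i).ncard := by
  have h : ∀ k, ∃ x, f k ∈ F.pathEdges x ∧ x ∈ F.leaves i := by
    intro k
    obtain ⟨y, hy, rfl⟩ := hf k
    obtain ⟨x, hx, hdeg⟩ := F.exists_leaf (F.pathEdges_subset y hy)
    refine ⟨x, hx, fun h ↦ F.notMem_pathEdges_root (F.root y) (f k) (h ▸ hx), ?_, hdeg⟩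
    rw [F.root_eq_of_mem hy hx]
    exact (F.path x).reachable
  choose g hg hg' using h
  have hginj : Function.Injective g := fun k l hkl ↦ by
    by_contra hne
    exact hinc k l hne _ (hg k) (hkl ▸ hg l)
  rw [← Nat.card_eq_fintype_card, ← Set.ncard_univ]
  exact Set.ncard_le_ncard_of_injOn g (fun k _ ↦ hg' k) hginj.injOn

theorem exists_of_mem_leaves {i : ι} {x : V} (hx : x ∈ F.leaves i) :
    F.root x = i ∧ ∃ e, ∀ z, e ∈ F.pathEdges z ↔ z = x := by
  obtain ⟨h1, h2, h3⟩ := hx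
  obtain rfl := F.root_eq h2
  exact ⟨rfl, F.exists_mem_pathEdges_iff_eq h1 h3⟩

end RootedForest

section Coloring

variable {G : SimpleGraph V} {v : ZMod 4 → V}
  (F : RootedForest (G.deleteEdges (cycleEdges v)) v)

theorem mem_edges_of_mem_pathEdges
    (F : RootedForest (G.deleteEdges (cycleEdges v)) v) {x y : V} {e : Sym2 V}
    (p : G.Walk x y) (hx : e ∈ F.pathEdges x) (hy : e ∉ F.pathEdges y) : e ∈ p.edges := by
  obtain ⟨d, hd, hd1, hd2⟩ := p.exists_boundary_dart {z | e ∈ F.pathEdges z} hx hy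
  have hH : (G.deleteEdges (cycleEdges v)).Adj d.fst d.snd := by
    refine deleteEdges_adj.2 ⟨d.adj, ?_⟩
    rintro ⟨k, hk⟩
    have : d.fst = v k ∨ d.fst = v (k + 1) := by
      rcases Sym2.eq_iff.1 hk with h | h
      exacts [.inl h.1, .inr h.1]
    rcases this with h | h <;> exact F.notMem_pathEdges_root _ e (h ▸ hd1)
  rw [F.eq_of_adj_of_mem_of_notMem hH hd1 hd2]
  exact List.mem_map_of_mem hd

theorem exists_cycleEdge_mem_edges {x y : V} (p : G.Walk x y) (S : Set (ZMod 4))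
    (hx : F.root x ∈ S) (hy : F.root y ∉ S) :
    ∃ k, s(v k, v (k + 1)) ∈ p.edges ∧ (k ∈ S ↔ k + 1 ∉ S) := by
  obtain ⟨d, hd, hd1, hd2⟩ := p.exists_boundary_dart {z | F.root z ∈ S} hx hy
  have hd' : s(d.fst, d.snd) ∈ p.edges := List.mem_map_of_mem hd
  simp only [Set.mem_ofPred_eq] at hd1 hd2
  by_cases hH : (G.deleteEdges (cycleEdges v)).Adj d.fst d.snd
  · exact absurd (F.root_eq_of_adj hH ▸ hd1) hd2
  · have : s(d.fst, d.snd) ∈ cycleEdges v := by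
      by_contra h
      exact hH (deleteEdges_adj.2 ⟨d.adj, h⟩)
    obtain ⟨k, hk⟩ := this
    refine ⟨k, hk ▸ hd', ?_⟩
    rcases Sym2.eq_iff.1 hk with ⟨h1, h2⟩ | ⟨h1, h2⟩
    all_goals
      rw [h1, F.root_self] at hd1
      rw [h2, F.root_self] at hd2
      tauto

theorem injOn_of_isRainbowConnected
    (F : RootedForest (G.deleteEdges (cycleEdges v)) v) {α : Type*} {c : Sym2 V → α}
    (hc : IsRainbowConnected G c) :
    Set.InjOn c (G.deleteEdges (cycleEdges v)).edgeSet := by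
  have key : ∀ e e' x y, e ∈ F.pathEdges x → e ∉ F.pathEdges y →
      (e' ∈ F.pathEdges x ∧ e' ∉ F.pathEdges y ∨ e' ∈ F.pathEdges y ∧ e' ∉ F.pathEdges x) →
      c e = c e' → e = e' := by
    intro e e' x y hx hy h' hcc
    obtain ⟨p, -, hp⟩ := hc x y
    have he := mem_edges_of_mem_pathEdges F p hx hy
    have he' : e' ∈ p.edges := by
      rcases h' with h' | h'
      · exact mem_edges_of_mem_pathEdges F p h'.1 h'.2
      · simpa using mem_edges_of_mem_pathEdges F p.reverse h'.1 h'.2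
    exact List.inj_on_of_nodup_map hp he he' hcc
  intro e he e' he' hcc
  obtain ⟨x, hx⟩ := F.exists_mem_pathEdges he
  obtain ⟨y, hy⟩ := F.exists_mem_pathEdges he'
  by_cases hx' : e' ∈ F.pathEdges x
  · exact key e e' x (v 0) hx (F.notMem_pathEdges_root _ _)
      (.inl ⟨hx', F.notMem_pathEdges_root _ _⟩) hcc
  by_cases hy' : e ∈ F.pathEdges y
  · exact key e e' y (v 0) hy' (F.notMem_pathEdges_root _ _)
      (.inl ⟨hy, F.notMem_pathEdges_root _ _⟩) hcc
  · exact key e e' x y hx hy' (.inr ⟨hy, hx'⟩) hcc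

/-- In a rainbow coloring in which every cycle edge shares its color with a forest edge `f k`,
the edges `f k` whose partner lies on a suitable rainbow path avoid the root paths of its ends. -/
theorem exists_edges_of_isRainbowConnected {α : Type*} {c : Sym2 V → α}
    (hc : IsRainbowConnected G c) {f : ZMod 4 → Sym2 V}
    (hf : ∀ k, f k ∈ (G.deleteEdges (cycleEdges v)).edgeSet)
    (hcf : ∀ k, c (f k) = c s(v k, v (k + 1))) {x y : V} (hxy : F.root x ≠ F.root y) :
    ∃ K : Set (ZMod 4), (∀ k ∈ K, f k ∉ F.pathEdges x ∧ f k ∉ F.pathEdges y) ∧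
      ∀ S : Set (ZMod 4), F.root x ∈ S → F.root y ∉ S → ∃ k ∈ K, (k ∈ S ↔ k + 1 ∉ S) := by
  obtain ⟨p, -, hp⟩ := hc x y
  refine ⟨{k | s(v k, v (k + 1)) ∈ p.edges}, fun k hk ↦ ?_,
    fun S hx hy ↦ exists_cycleEdge_mem_edges F p S hx hy⟩
  have hfp : f k ∉ p.edges := fun h ↦ by
    have h2 := hf k
    rw [List.inj_on_of_nodup_map hp h hk (hcf k)] at h2
    exact (deleteEdges_adj.1 h2).2 ⟨k, rfl⟩
  refine ⟨fun h ↦ hfp ?_, fun h ↦ hfp ?_⟩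
  · exact mem_edges_of_mem_pathEdges F p h fun h' ↦ hxy (F.root_eq_of_mem h h')
  · simpa using mem_edges_of_mem_pathEdges F p.reverse h
      fun h' ↦ hxy (F.root_eq_of_mem h' h)

theorem near_of_isRainbowConnected {α : Type*} {c : Sym2 V → α}
    (hc : IsRainbowConnected G c) {f : ZMod 4 → Sym2 V}
    (hf : ∀ k, f k ∈ (G.deleteEdges (cycleEdges v)).edgeSet)
    (hcf : ∀ k, c (f k) = c s(v k, v (k + 1))) {i j : ZMod 4} (hij : j ≠ i) {x y : V}
    (hx : F.root x = i) (hy : F.root y = i + 1)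
    (hi : f i ∈ F.pathEdges x ∨ f i ∈ F.pathEdges y) :
    f j ∉ F.pathEdges x ∧ f j ∉ F.pathEdges y := by
  obtain ⟨K, hK, hS⟩ := exists_edges_of_isRainbowConnected F hc hf hcf (x := x) (y := y)
    (by rw [hx, hy]; simp; decide)
  rw [hx, hy] at hS
  have hiK : i ∉ K := fun h ↦ by have := hK i h; tauto
  obtain ⟨S, h1, h2, h3⟩ : ∃ S : Finset (ZMod 4), i ∈ S ∧ i + 1 ∉ S ∧
      ∀ k, (k ∈ S ↔ k + 1 ∉ S) → k = i ∨ k = j := by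
    clear hx hy hi hiK hS
    revert i j
    decide
  obtain ⟨k, hk, hkS⟩ := hS S h1 h2
  rcases h3 k hkS with rfl | rfl
  · exact absurd hk hiK
  · exact hK _ hk

theorem opposite_of_isRainbowConnected {α : Type*} {c : Sym2 V → α}
    (hc : IsRainbowConnected G c) {f : ZMod 4 → Sym2 V}
    (hf : ∀ k, f k ∈ (G.deleteEdges (cycleEdges v)).edgeSet)
    (hcf : ∀ k, c (f k) = c s(v k, v (k + 1))) {i a b : ZMod 4}
    (ha : a = i ∨ a = i + 1) (hb : b = i + 2 ∨ b = i + 3) {x y : V}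
    (hx : F.root x = i) (hy : F.root y = i + 2)
    (hi : f a ∈ F.pathEdges x ∨ f a ∈ F.pathEdges y) :
    f b ∉ F.pathEdges x ∧ f b ∉ F.pathEdges y := by
  obtain ⟨K, hK, hS⟩ := exists_edges_of_isRainbowConnected F hc hf hcf (x := x) (y := y)
    (by rw [hx, hy]; simp; decide)
  rw [hx, hy] at hS
  have hiK : a ∉ K := fun h ↦ by have := hK a h; tauto
  obtain ⟨S, h1, h2, h3⟩ : ∃ S : Finset (ZMod 4), i ∈ S ∧ i + 2 ∉ S ∧
      ∀ k, (k ∈ S ↔ k + 1 ∉ S) → k = a ∨ k = b := by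
    clear hx hy hi hiK hS
    revert i a b
    decide
  obtain ⟨k, hk, hkS⟩ := hS S h1 h2
  rcases h3 k hkS with rfl | rfl
  · exact absurd hk hiK
  · exact hK _ hk

set_option maxRecDepth 100000 in
set_option synthInstance.maxHeartbeats 400000 in
set_option synthInstance.maxSize 4000 in
theorem index_classification (t : ZMod 4 → ZMod 4)
    (hnear : ∀ i j, j ≠ i → (t i = i → t j ≠ i + 1) ∧ (t i = i + 1 → t j ≠ i))
    (hopp : ∀ i a b, (a = i ∨ a = i + 1) → (b = i + 2 ∨ b = i + 3) →
      (t a = i → t b ≠ i + 2) ∧ (t a = i + 2 → t b ≠ i)) :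
    (∃ i, ∀ k, t k = i) ∨
      ∃ j, t (j + 1) = j ∧ t (j + 2) = j ∧ t j = j + 3 ∧ t (j + 3) = j + 1 := by
  revert t
  decide

/-- If every cycle edge shares its color with a forest edge in a rainbow coloring, then there are
many leaves at a cycle vertex, or at three consecutive ones. -/
theorem leaves_of_isRainbowConnected [Finite V] {α : Type*} {c : Sym2 V → α}
    (hc : IsRainbowConnected G c) {f : ZMod 4 → Sym2 V}
    (hf : ∀ k, f k ∈ (G.deleteEdges (cycleEdges v)).edgeSet)
    (hcf : ∀ k, c (f k) = c s(v k, v (k + 1))) :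
    ∃ i, 4 ≤ (F.leaves i).ncard ∨ (1 ≤ (F.leaves i).ncard ∧ 2 ≤ (F.leaves (i + 1)).ncard ∧
      1 ≤ (F.leaves (i + 2)).ncard) := by
  choose x hx using fun k ↦ F.exists_mem_pathEdges (hf k)
  have near : ∀ {i j}, j ≠ i → ∀ {x y}, F.root x = i → F.root y = i + 1 →
      f i ∈ F.pathEdges x ∨ f i ∈ F.pathEdges y → f j ∉ F.pathEdges x ∧ f j ∉ F.pathEdges y :=
    fun hij _ _ hx hy ↦ near_of_isRainbowConnected F hc hf hcf hij hx hy
  have opp : ∀ {i a b}, (a = i ∨ a = i + 1) → (b = i + 2 ∨ b = i + 3) → ∀ {x y},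
      F.root x = i → F.root y = i + 2 →
      f a ∈ F.pathEdges x ∨ f a ∈ F.pathEdges y → f b ∉ F.pathEdges x ∧ f b ∉ F.pathEdges y :=
    fun ha hb _ _ hx hy ↦ opposite_of_isRainbowConnected F hc hf hcf ha hb hx hy
  have one_le : ∀ i k, F.root (x k) = i → 1 ≤ (F.leaves i).ncard := fun i k hk ↦
    F.card_le_ncard_leaves (κ := Unit) (fun _ ↦ f k) (fun _ ↦ ⟨x k, hx k, hk⟩)
      fun k l hkl ↦ absurd rfl hkl
  have inc_symm : ∀ {a b}, (∀ z, f a ∈ F.pathEdges z → f b ∉ F.pathEdges z) →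
      ∀ z, f b ∈ F.pathEdges z → f a ∉ F.pathEdges z := fun h z hb ha ↦ h z ha hb
  have inc_opp : ∀ i, F.root (x (i + 1)) = i →
      ∀ z, f (i + 1) ∈ F.pathEdges z → f (i + 2) ∉ F.pathEdges z := fun i hi z hz ↦
    (opp (.inr rfl) (.inl rfl) ((F.root_eq_of_mem hz (hx _)).trans hi) (F.root_self _)
      (.inl hz)).1
  rcases index_classification (fun k ↦ F.root (x k))
    (fun i j hij ↦ ⟨fun h h' ↦ (near hij h h' (.inl (hx i))).2 (hx j),
      fun h h' ↦ (near hij h' h (.inr (hx i))).1 (hx j)⟩)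
    (fun i a b ha hb ↦ ⟨fun h h' ↦ (opp ha hb h h' (.inl (hx a))).2 (hx b),
      fun h h' ↦ (opp ha hb h' h (.inr (hx a))).1 (hx b)⟩) with ⟨i, hi⟩ | ⟨j, h1, h2, h3, h4⟩
  · refine ⟨i, .inl ?_⟩
    have inc1 : ∀ j, j ≠ i → ∀ z, f i ∈ F.pathEdges z → f j ∉ F.pathEdges z := fun j hj z hz ↦
      (near hj ((F.root_eq_of_mem hz (hx i)).trans (hi i)) (F.root_self _) (.inl hz)).1
    have inc2 : ∀ j, j ≠ i + 3 → ∀ z, f (i + 3) ∈ F.pathEdges z → f j ∉ F.pathEdges z :=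
      fun j hj z hz ↦ (near hj (F.root_self _)
        (((F.root_eq_of_mem hz (hx (i + 3))).trans (hi _)).trans (by grind)) (.inr hz)).2
    have inc3 := inc_opp i (hi _)
    have hcard := F.card_le_ncard_leaves f (i := i) (fun k ↦ ⟨x k, hx k, hi k⟩) ?_
    · rwa [ZMod.card] at hcard
    · intro k l hkl
      have hk : k = i ∨ k = i + 3 ∨ l = i ∨ l = i + 3 ∨ (k = i + 1 ∧ l = i + 2) ∨
          (k = i + 2 ∧ l = i + 1) := by
        clear hi inc1 inc2 inc3
        revert i k l
        decide
      rcases hk with rfl | rfl | rfl | rfl | ⟨rfl, rfl⟩ | ⟨rfl, rfl⟩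
      · exact inc1 l hkl.symm
      · exact inc2 l hkl.symm
      · exact inc_symm (inc1 k hkl)
      · exact inc_symm (inc2 k hkl)
      · exact inc3
      · exact inc_symm inc3
  · refine ⟨j + 3, .inr ⟨one_le _ _ h3, ?_, ?_⟩⟩
    · have hinc := inc_opp j h1
      rw [show j + 3 + 1 = j by grind]
      refine F.card_le_ncard_leaves (κ := Bool) (fun b ↦ if b then f (j + 1) else f (j + 2)) ?_ ?_
      · rintro (_ | _)
        · exact ⟨_, hx (j + 2), h2⟩
        · exact ⟨_, hx (j + 1), h1⟩
      · rintro (_ | _) (_ | _) h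
        · exact absurd rfl h
        · simpa using inc_symm hinc
        · simpa using hinc
        · exact absurd rfl h
    · exact one_le _ _ (h4.trans (by grind))

theorem exists_isPath_of_injOn {α : Type*} {c : Sym2 V → α} {x y : V} (p : G.Walk x y)
    (hp : Set.InjOn c {e | e ∈ p.edges}) :
    ∃ q : G.Walk x y, q.IsPath ∧ (q.edges.map c).Nodup := by
  classical
  refine ⟨p.bypass, p.bypass_isPath, List.Nodup.map_on ?_ p.bypass_isPath.isTrail.edges_nodup⟩
  exact fun e he e' he' h ↦
    hp (p.edges_bypass_subset_edges he) (p.edges_bypass_subset_edges he') h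

theorem exists_walk_edges_eq {x y : V} (q : G.Walk (v (F.root x)) (v (F.root y))) :
    ∃ p : G.Walk x y, {e | e ∈ p.edges} =
      F.pathEdges x ∪ F.pathEdges y ∪ {e | e ∈ q.edges} := by
  refine ⟨(((F.path x).mapLe (deleteEdges_le _)).reverse.append q).append
    ((F.path y).mapLe (deleteEdges_le _)), ?_⟩
  ext e
  simp [RootedForest.pathEdges]
  tauto

/-- The coloring giving every forest edge its own color, and the cycle edge from `v k` to
`v (k + 1)` the color of the forest edge `g k`, or the extra color if `g k` is `none`. -/
noncomputable def forestColoring (v : ZMod 4 → V) (g : ZMod 4 → Option (Sym2 V)) (e : Sym2 V) :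
    Option (Sym2 V) :=
  open Classical in if h : e ∈ cycleEdges v then g h.choose else some e

theorem forestColoring_cycleEdge (hinj : Function.Injective v) (g : ZMod 4 → Option (Sym2 V))
    (k : ZMod 4) : forestColoring v g s(v k, v (k + 1)) = g k := by
  have h : s(v k, v (k + 1)) ∈ cycleEdges v := ⟨k, rfl⟩
  rw [forestColoring, dif_pos h]
  exact congrArg g (cycleEdge_injective hinj h.choose_spec).symm

theorem forestColoring_of_mem (g : ZMod 4 → Option (Sym2 V)) {e : Sym2 V}
    (he : e ∈ (G.deleteEdges (cycleEdges v)).edgeSet) : forestColoring v g e = some e := by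
  rw [edgeSet_deleteEdges] at he
  exact dif_neg he.2

theorem injOn_forestColoring (hinj : Function.Injective v) {g : ZMod 4 → Option (Sym2 V)}
    {E : Set (Sym2 V)} {K : Set (ZMod 4)}
    (hE : E ⊆ (G.deleteEdges (cycleEdges v)).edgeSet) (hg : Set.InjOn g K)
    (hgE : ∀ k ∈ K, ∀ e ∈ E, g k ≠ some e) :
    Set.InjOn (forestColoring v g) (E ∪ (fun k ↦ s(v k, v (k + 1))) '' K) := by
  rintro e (he | ⟨k, hk, rfl⟩) e' (he' | ⟨k', hk', rfl⟩) h
  · rw [forestColoring_of_mem g (hE he), forestColoring_of_mem g (hE he')] at h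
    exact Option.some.inj h
  · rw [forestColoring_of_mem g (hE he), forestColoring_cycleEdge hinj] at h
    exact absurd h.symm (hgE k' hk' e he)
  · rw [forestColoring_of_mem g (hE he'), forestColoring_cycleEdge hinj] at h
    exact absurd h (hgE k hk e' he')
  · simp only [forestColoring_cycleEdge hinj] at h
    simp only [hg hk hk' h]

/-- The forest edge `o`, if any, lies on neither of the root paths of `x` and `y`. -/
def RootedForest.Avoids (o : Option (Sym2 V)) (x y : V) : Prop :=
  ∀ e, o = some e → e ∉ F.pathEdges x ∧ e ∉ F.pathEdges y

theorem isRainbowConnected_forestColoring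
    (F : RootedForest (G.deleteEdges (cycleEdges v)) v) (hinj : Function.Injective v)
    (hadj : ∀ i, G.Adj (v i) (v (i + 1))) {g : ZMod 4 → Option (Sym2 V)}
    (hnear : ∀ i x y, F.root x = i → F.root y = i + 1 → F.Avoids (g i) x y)
    (hopp : ∀ i x y, F.root x = i → F.root y = i + 2 →
      (g i ≠ g (i + 1) ∧ F.Avoids (g i) x y ∧ F.Avoids (g (i + 1)) x y) ∨
      (g (i + 2) ≠ g (i + 3) ∧ F.Avoids (g (i + 2)) x y ∧ F.Avoids (g (i + 3)) x y)) :
    IsRainbowConnected G (forestColoring v g) := by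
  let Good (x y : V) : Prop :=
    ∃ p : G.Walk x y, Set.InjOn (forestColoring v g) {e | e ∈ p.edges}
  have symm : ∀ {x y}, Good x y → Good y x := fun ⟨p, hp⟩ ↦ ⟨p.reverse, by simpa using hp⟩
  have of_route : ∀ {x y} (q : G.Walk (v (F.root x)) (v (F.root y))) (K : Set (ZMod 4)),
      {e | e ∈ q.edges} = (fun k ↦ s(v k, v (k + 1))) '' K → Set.InjOn g K →
      (∀ k ∈ K, F.Avoids (g k) x y) → Good x y := by
    intro x y q K hq hg hK
    obtain ⟨p, hp⟩ := exists_walk_edges_eq F q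
    refine ⟨p, ?_⟩
    rw [hp, hq]
    refine injOn_forestColoring hinj
      (Set.union_subset (F.pathEdges_subset x) (F.pathEdges_subset y)) hg ?_
    rintro k hk e (he | he) h
    exacts [(hK k hk e h).1 he, (hK k hk e h).2 he]
  have near : ∀ i x y, F.root x = i → F.root y = i + 1 → Good x y := by
    intro i x y hx hy
    refine of_route (((hadj i).toWalk).copy (by rw [hx]) (by rw [hy])) {i} ?_ (by simp) ?_
    · ext e; simp
    · rintro _ rfl
      exact hnear _ x y hx hy
  have two : ∀ i x y, F.root x = i → F.root y = i + 2 → g i ≠ g (i + 1) →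
      F.Avoids (g i) x y → F.Avoids (g (i + 1)) x y → Good x y := by
    intro i x y hx hy hne h1 h2
    refine of_route ((Walk.cons (hadj i) (hadj (i + 1)).toWalk).copy (by rw [hx])
      (by rw [hy]; congr 1; grind)) {i, i + 1} ?_ ?_ ?_
    · ext e; simp [eq_comm]
    · simpa [Set.injOn_insert, show (1 : ZMod 4) ≠ 0 by decide] using hne
    · rintro _ (rfl | rfl)
      exacts [h1, h2]
  have avoids_symm : ∀ {o x y}, F.Avoids o x y → F.Avoids o y x := fun h e he ↦ (h e he).symm
  intro x y
  suffices h : Good x y by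
    obtain ⟨p, hp⟩ := h
    exact exists_isPath_of_injOn p hp
  rcases zmod4_eq_add (F.root x) (F.root y) with h | h | h | h
  · refine ⟨((F.path x).mapLe (deleteEdges_le _)).reverse.append
      (((F.path y).mapLe (deleteEdges_le _)).copy (by rw [h]) rfl), fun e he e' he' hee ↦ ?_⟩
    have hH : ∀ e, e ∈ (((F.path x).mapLe (deleteEdges_le (G := G) _)).reverse.append
        (((F.path y).mapLe (deleteEdges_le (G := G) _)).copy (by rw [h]) rfl)).edges →
        e ∈ (G.deleteEdges (cycleEdges v)).edgeSet := by
      intro e he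
      simp at he
      exact he.elim (fun h ↦ F.pathEdges_subset x h) fun h ↦ F.pathEdges_subset y h
    rw [forestColoring_of_mem g (hH e he), forestColoring_of_mem g (hH e' he')] at hee
    exact Option.some.inj hee
  · exact near _ x y rfl h
  · rcases hopp _ x y rfl h with ⟨h1, h2, h3⟩ | ⟨h1, h2, h3⟩
    · exact two _ x y rfl h h1 h2 h3
    · refine symm (two _ y x h (by grind) ?_ (avoids_symm h2) (avoids_symm ?_))
      · rwa [show F.root x + 2 + 1 = F.root x + 3 by grind]
      · rwa [show F.root x + 2 + 1 = F.root x + 3 by grind]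
  · exact symm (near _ y x rfl h.symm)

theorem zmod4_add_add (i : ZMod 4) :
    i + 1 + 1 = i + 2 ∧ i + 1 + 2 = i + 3 ∧ i + 1 + 3 = i ∧ i + 2 + 1 = i + 3 ∧ i + 2 + 2 = i ∧
      i + 2 + 3 = i + 1 ∧ i + 3 + 1 = i ∧ i + 3 + 2 = i + 1 ∧ i + 3 + 3 = i + 2 := by
  revert i
  decide

theorem zmod4_ne_add (i : ZMod 4) :
    i + 1 ≠ i ∧ i + 2 ≠ i ∧ i + 3 ≠ i ∧ i + 2 ≠ i + 1 ∧ i + 3 ≠ i + 1 ∧ i + 3 ≠ i + 2 := by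
  revert i
  decide

theorem zmod4_cases (i k : ZMod 4) : k = i ∨ k = i + 1 ∨ k = i + 2 ∨ k = i + 3 := by
  revert i k
  decide

variable {F}

theorem RootedForest.avoids_none (x y : V) : F.Avoids none x y := fun _ h ↦ absurd h (by simp)

theorem RootedForest.avoids_some {e : Sym2 V} {x y z : V} (he : e ∈ F.pathEdges z)
    (hx : F.root x ≠ F.root z) (hy : F.root y ≠ F.root z) : F.Avoids (some e) x y := by
  rintro _ ⟨⟩
  exact ⟨fun h ↦ hx (F.root_eq_of_mem h he), fun h ↦ hy (F.root_eq_of_mem h he)⟩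

theorem exists_isRainbowConnected_of_adjacent (hinj : Function.Injective v)
    (hadj : ∀ i, G.Adj (v i) (v (i + 1))) {i : ZMod 4} {a b : Sym2 V} {xa xb : V}
    (ha : a ∈ F.pathEdges xa) (hb : b ∈ F.pathEdges xb)
    (hxa : F.root xa = i) (hxb : F.root xb = i + 1) :
    ∃ g : ZMod 4 → Option (Sym2 V), (∀ k e, g k = some e → e = a ∨ e = b) ∧
      IsRainbowConnected G (forestColoring v g) := by
  obtain ⟨h1, h2, h3, h4, h5, h6, h7, h8, h9⟩ := zmod4_add_add i
  obtain ⟨n1, n2, n3, n4, n5, n6⟩ := zmod4_ne_add i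
  let g (k : ZMod 4) : Option (Sym2 V) :=
    if k = i + 1 then some a else if k = i + 3 then some b else none
  have g0 : g i = none := by simp [g, n1.symm, n3.symm]
  have g1 : g (i + 1) = some a := by simp [g]
  have g2 : g (i + 2) = none := by simp [g, n4, n6.symm]
  have g3 : g (i + 3) = some b := by simp [g, n5]
  refine ⟨g, fun k e h ↦ by grind, isRainbowConnected_forestColoring F hinj hadj ?_ ?_⟩
  · intro k x y hx hy
    rcases zmod4_cases i k with rfl | rfl | rfl | rfl
    · exact g0 ▸ RootedForest.avoids_none x y
    · exact g1 ▸ RootedForest.avoids_some ha (by grind) (by grind)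
    · exact g2 ▸ RootedForest.avoids_none x y
    · exact g3 ▸ RootedForest.avoids_some hb (by grind) (by grind)
  · intro k x y hx hy
    rcases zmod4_cases i k with rfl | rfl | rfl | rfl
    · exact .inr ⟨by simp [g2, g3], g2 ▸ RootedForest.avoids_none x y,
        g3 ▸ RootedForest.avoids_some hb (by grind) (by grind)⟩
    · rw [h1, g1, g2]
      exact .inl ⟨by simp, RootedForest.avoids_some ha (by grind) (by grind),
        RootedForest.avoids_none x y⟩
    · rw [h4, g2, g3]
      exact .inl ⟨by simp, RootedForest.avoids_none x y,
        RootedForest.avoids_some hb (by grind) (by grind)⟩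
    · rw [h8, h9, g1, g2]
      exact .inr ⟨by simp, RootedForest.avoids_some ha (by grind) (by grind),
        RootedForest.avoids_none x y⟩

theorem exists_isRainbowConnected_of_incomparable (hinj : Function.Injective v)
    (hadj : ∀ i, G.Adj (v i) (v (i + 1))) {i : ZMod 4} {a b : Sym2 V} {xa xb : V}
    (ha : a ∈ F.pathEdges xa) (hb : b ∈ F.pathEdges xb)
    (hxa : F.root xa = i) (hxb : F.root xb = i)
    (hab : ∀ z, a ∈ F.pathEdges z → b ∉ F.pathEdges z) :
    ∃ g : ZMod 4 → Option (Sym2 V), (∀ k e, g k = some e → e = a ∨ e = b) ∧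
      IsRainbowConnected G (forestColoring v g) := by
  obtain ⟨h1, h2, h3, h4, h5, h6, h7, h8, h9⟩ := zmod4_add_add i
  obtain ⟨n1, n2, n3, n4, n5, n6⟩ := zmod4_ne_add i
  let g (k : ZMod 4) : Option (Sym2 V) :=
    if k = i + 1 then some a else if k = i + 2 then some b else none
  have g0 : g i = none := by simp [g, n1.symm, n2.symm]
  have g1 : g (i + 1) = some a := by simp [g]
  have g2 : g (i + 2) = some b := by simp [g, n4]
  have g3 : g (i + 3) = none := by simp [g, n5, n6]
  have hne : a ≠ b := fun h ↦ hab xa ha (h ▸ ha)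
  have one : ∀ {x y}, F.root x ≠ i → F.root y = i → F.Avoids (some a) y x ∨
      F.Avoids (some b) y x := by
    intro x y hx hy
    by_cases h : a ∈ F.pathEdges y
    · right
      rintro _ ⟨⟩
      exact ⟨hab y h, fun h' ↦ hx ((F.root_eq_of_mem h' hb).trans hxb)⟩
    · left
      rintro _ ⟨⟩
      exact ⟨h, fun h' ↦ hx ((F.root_eq_of_mem h' ha).trans hxa)⟩
  have avoids_symm : ∀ {o x y}, F.Avoids o x y → F.Avoids o y x := fun h e he ↦ (h e he).symm
  refine ⟨g, fun k e h ↦ by grind, isRainbowConnected_forestColoring F hinj hadj ?_ ?_⟩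
  · intro k x y hx hy
    rcases zmod4_cases i k with rfl | rfl | rfl | rfl
    · exact g0 ▸ RootedForest.avoids_none x y
    · exact g1 ▸ RootedForest.avoids_some ha (by grind) (by grind)
    · exact g2 ▸ RootedForest.avoids_some hb (by grind) (by grind)
    · exact g3 ▸ RootedForest.avoids_none x y
  · intro k x y hx hy
    rcases zmod4_cases i k with rfl | rfl | rfl | rfl
    · rw [g0, g1, g2, g3]
      exact (one (hy ▸ n2) hx).imp (fun h ↦ ⟨by simp, RootedForest.avoids_none x y, h⟩)
        fun h ↦ ⟨by simp, h, RootedForest.avoids_none x y⟩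
    · rw [h1, g1, g2]
      exact .inl ⟨by simpa using hne, RootedForest.avoids_some ha (by grind) (by grind),
        RootedForest.avoids_some hb (by grind) (by grind)⟩
    · rw [h4, h5, h6, g0, g1, g2, g3]
      exact (one (hx ▸ n2) (hy.trans h5)).symm.imp
        (fun h ↦ ⟨by simp, avoids_symm h, RootedForest.avoids_none x y⟩)
        fun h ↦ ⟨by simp, RootedForest.avoids_none x y, avoids_symm h⟩
    · rw [h8, h9, g1, g2]
      exact .inr ⟨by simpa using hne, RootedForest.avoids_some ha (by grind) (by grind),
        RootedForest.avoids_some hb (by grind) (by grind)⟩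

end Coloring

end Tree

theorem IsRainbowConnected.exists_fin {V α : Type*} {G : SimpleGraph V} {c : Sym2 V → α}
    (hc : IsRainbowConnected G c) {s : Set α} (hs : s.Finite) (hne : s.Nonempty)
    (h : ∀ e ∈ G.edgeSet, c e ∈ s) :
    ∃ c' : Sym2 V → Fin s.ncard, IsRainbowConnected G c' := by
  classical
  have := hs.to_subtype
  let φ : s ≃ Fin s.ncard := Finite.equivFin s
  refine ⟨fun e ↦ if he : c e ∈ s then φ ⟨c e, he⟩ else φ ⟨_, hne.some_mem⟩, fun x y ↦ ?_⟩
  obtain ⟨p, hp, hnd⟩ := hc x y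
  refine ⟨p, hp, List.Nodup.map_on (fun e he e' he' hee ↦ ?_) hp.isTrail.edges_nodup⟩
  have h1 := h e (p.edges_subset_edgeSet he)
  have h2 := h e' (p.edges_subset_edgeSet he')
  simp only [h1, h2, dite_true, φ.injective.eq_iff, Subtype.mk.injEq] at hee
  exact List.inj_on_of_nodup_map hnd he he' hee

theorem exists_forestColoring_isRainbowConnected {V : Type*} [Finite V] {G : SimpleGraph V}
    {v : ZMod 4 → V} (F : RootedForest (G.deleteEdges (cycleEdges v)) v)
    (hinj : Function.Injective v) (hadj : ∀ i, G.Adj (v i) (v (i + 1)))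
    (hl : ¬ ∃ i : ZMod 4, (F.leaves i).ncard = 0 ∧ (F.leaves (i + 2)).ncard = 0 ∧
      (F.leaves (i + 1)).ncard ≤ 1 ∧ (F.leaves (i + 3)).ncard ≤ 1) :
    ∃ g : ZMod 4 → Option (Sym2 V),
      (∀ k e, g k = some e → e ∈ (G.deleteEdges (cycleEdges v)).edgeSet) ∧
      IsRainbowConnected G (forestColoring v g) := by
  by_cases h2 : ∃ i, 1 < (F.leaves i).ncard
  · obtain ⟨i, hi⟩ := h2
    obtain ⟨x, hx, y, hy, hxy⟩ := (Set.one_lt_ncard).1 hi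
    obtain ⟨rx, a, ha⟩ := F.exists_of_mem_leaves hx
    obtain ⟨ry, b, hb⟩ := F.exists_of_mem_leaves hy
    obtain ⟨g, hg, hc⟩ := exists_isRainbowConnected_of_incomparable hinj hadj
      ((ha x).2 rfl) ((hb y).2 rfl) rx ry
      (fun z hz hz' ↦ hxy (((ha z).1 hz).symm.trans ((hb z).1 hz')))
    refine ⟨g, fun k e he ↦ ?_, hc⟩
    rcases hg k e he with rfl | rfl
    exacts [F.pathEdges_subset x ((ha x).2 rfl), F.pathEdges_subset y ((hb y).2 rfl)]
  · push Not at h2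
    obtain ⟨i, hi, hi'⟩ : ∃ i, (F.leaves i).ncard ≠ 0 ∧ (F.leaves (i + 1)).ncard ≠ 0 := by
      by_contra! h
      have key : ∀ i, (F.leaves i).ncard ≠ 0 ∨ (F.leaves (i + 2)).ncard ≠ 0 := fun i ↦ by
        by_contra! h0
        exact hl ⟨i, h0.1, h0.2, h2 _, h2 _⟩
      have e1 : (2 : ZMod 4) + 1 = 3 := by decide
      have e2 : (3 : ZMod 4) + 1 = 0 := by decide
      have e3 : (1 : ZMod 4) + 1 = 2 := by decide
      have e4 : (1 : ZMod 4) + 2 = 3 := by decide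
      have k0 := key 0
      have k1 := key 1
      have a0 := h 0
      have a1 := h 1
      have a2 := h 2
      have a3 := h 3
      simp only [e1, e2, e3, e4, zero_add] at k0 k1 a0 a1 a2 a3
      tauto
    obtain ⟨x, hx⟩ := Set.nonempty_of_ncard_ne_zero hi
    obtain ⟨y, hy⟩ := Set.nonempty_of_ncard_ne_zero hi'
    obtain ⟨rx, a, ha⟩ := F.exists_of_mem_leaves hx
    obtain ⟨ry, b, hb⟩ := F.exists_of_mem_leaves hy
    obtain ⟨g, hg, hc⟩ := exists_isRainbowConnected_of_adjacent hinj hadj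
      ((ha x).2 rfl) ((hb y).2 rfl) rx ry
    refine ⟨g, fun k e he ↦ ?_, hc⟩
    rcases hg k e he with rfl | rfl
    exacts [F.pathEdges_subset x ((ha x).2 rfl), F.pathEdges_subset y ((hb y).2 rfl)]

/-- Let `G` be a connected unicyclic graph with m edges whose unique
cycle `v₁v₂v₃v₄v₁` has length 4. If there is no index `i` (mod 4) with
`l(vᵢ) = l(v_{i+2}) = 0`, `l(v_{i+1}) ≤ 1` and `l(v_{i+3}) ≤ 1`, and no index `i`
(mod 4) with `l(vᵢ) ≥ 4` or with `l(vᵢ) ≥ 1`, `l(v_{i+1}) ≥ 2` and `l(v_{i+2}) ≥ 1`,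
then rc(G) = m − 3. -/
theorem stmt_12 {V : Type*} [Fintype V] (G : SimpleGraph V)
    (hconn : G.Connected) (huni : G.edgeSet.ncard = Fintype.card V)
    (v : ZMod 4 → V) (hinj : Function.Injective v)
    (hadj : ∀ i : ZMod 4, G.Adj (v i) (v (i + 1)))
    (hl₁ : ¬ ∃ i : ZMod 4, numLeaves G v i = 0 ∧ numLeaves G v (i + 2) = 0 ∧
      numLeaves G v (i + 1) ≤ 1 ∧ numLeaves G v (i + 3) ≤ 1)
    (hl₂ : ¬ ∃ i : ZMod 4, 4 ≤ numLeaves G v i ∨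
      (1 ≤ numLeaves G v i ∧ 2 ≤ numLeaves G v (i + 1) ∧ 1 ≤ numLeaves G v (i + 2))) :
    rc G = G.edgeSet.ncard - 3 := by
  set H := G.deleteEdges (cycleEdges v) with hH
  obtain ⟨F⟩ : Nonempty (RootedForest H v) := RootedForest.nonempty_of_reachable
    (isAcyclic_deleteEdges_cycleEdges hconn huni hinj hadj)
    (exists_reachable_deleteEdges_cycleEdges hconn v)
    (fun i j ↦ eq_of_reachable_deleteEdges_cycleEdges hconn huni hinj hadj)
  have hcard : H.edgeSet.ncard + 4 = G.edgeSet.ncard :=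
    ncard_edgeSet_deleteEdges_cycleEdges hinj hadj
  rw [show G.edgeSet.ncard - 3 = H.edgeSet.ncard + 1 by omega]
  have hmem : H.edgeSet.ncard + 1 ∈
      {k : ℕ | ∃ c : Sym2 V → Fin k, IsRainbowConnected G c} := by
    obtain ⟨g, hg, hc⟩ := exists_forestColoring_isRainbowConnected F hinj hadj hl₁
    have hs : (insert none (some '' H.edgeSet)).ncard = H.edgeSet.ncard + 1 := by
      rw [Set.ncard_insert_of_notMem (by simp),
        (Option.some_injective _).injOn.ncard_image]
    rw [← hs]
    refine hc.exists_fin (Set.toFinite _) ⟨none, by simp⟩ fun e he ↦ ?_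
    by_cases hcyc : e ∈ cycleEdges v
    · obtain ⟨k, rfl⟩ := hcyc
      rw [forestColoring_cycleEdge hinj]
      cases hk : g k with
      | none => simp
      | some e' => exact Or.inr ⟨e', hg k e' hk, rfl⟩
    · have heH : e ∈ H.edgeSet := by
        rw [hH, edgeSet_deleteEdges]
        exact ⟨he, hcyc⟩
      rw [forestColoring_of_mem g heH]
      simpa using heH
  refine le_antisymm (Nat.sInf_le hmem) ?_
  by_contra! hlt
  obtain ⟨c, hc⟩ : rc G ∈ {k : ℕ | ∃ c : Sym2 V → Fin k, IsRainbowConnected G c} :=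
    Nat.sInf_mem ⟨_, hmem⟩
  have hinjOn : Set.InjOn c H.edgeSet := injOn_of_isRainbowConnected F hc
  have himg : c '' H.edgeSet = Set.univ := by
    refine Set.eq_of_subset_of_ncard_le (Set.subset_univ _) ?_
    rw [hinjOn.ncard_image, Set.ncard_univ,
      Nat.card_eq_fintype_card, Fintype.card_fin]
    omega
  have hsurj : ∀ k : ZMod 4, ∃ e ∈ H.edgeSet, c e = c s(v k, v (k + 1)) := fun k ↦
    (Set.mem_image c H.edgeSet _).mp (himg ▸ Set.mem_univ _)
  choose f hf hcf using hsurj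
  exact hl₂ (leaves_of_isRainbowConnected F hc hf hcf)
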